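/- arXiv:1712.03583 — 3 statements merged into one kernel-verified Lean document; each statement's English description precedes it below -/
import Mathlib

section
/- Let C ⊆ ℝ^n be a nonempty convex compact set, f : C × C → ℝ an equilibrium bifunction, K : C ⇉ C lower semicontinuous with nonempty convex values and fix K closed, and F(x) := {y ∈ C : f(x,y) < 0}. Assume (i) F(x) is convex for every x ∈ fix K; (ii) F is lower semicontinuous at every point of fix K; (iii) x ↦ F(x) ∩ K(x) is lower semicontinuous at every point of ∂_C fix K. Then there exists a solution x of the quasiequilibrium problem (x ∈ K(x) and f(x,y) ≥ 0 for all y ∈ K(x)) such that, in addition, x ∈ ∂_C fix K or (x ∈ int_C fix K and f(x,y) ≥ 0 for all y ∈ C). -/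
open Set Topology Filter

/-- A set-valued map `Φ : X ⇉ Y` is lower semicontinuous at `x` if for every open set `Ω`
with `Φ x ∩ Ω ≠ ∅` there is a neighborhood of `x` on which `Φ x' ∩ Ω ≠ ∅`. -/
def LscAt {X Y : Type*} [TopologicalSpace X] [TopologicalSpace Y]
    (Φ : X → Set Y) (x : X) : Prop :=
  ∀ Ω : Set Y, IsOpen Ω → (Φ x ∩ Ω).Nonempty → ∀ᶠ x' in 𝓝 x, (Φ x' ∩ Ω).Nonempty


namespace Scarf

variable {I X : Type*}

/-- A finite set `τ` is dominant for the rankings `r i` if no element of `X` ranks, for every `i`,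
strictly above some element of `τ`. -/
def Dominant (r : I → X → ℕ) (τ : Finset X) : Prop :=
  ∀ y, ∃ i, ∀ x ∈ τ, r i y ≤ r i x

lemma Dominant.mono {r : I → X → ℕ} {σ τ : Finset X} (h : Dominant r τ) (hst : σ ⊆ τ) :
    Dominant r σ := fun y => (h y).imp fun _ hi x hx => hi x (hst hx)

variable [Fintype I] [DecidableEq I] [DecidableEq X]

open scoped Classical in
/-- A set of size `card I` missing a color has an even number of facets colored by
all colors but `i`. -/
lemma even_card_facets {c : X → I} {i : I} {τ : Finset X}
    (hτ : τ.card = Fintype.card I) (hc : τ.image c ≠ Finset.univ) :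
    Even (τ.filter fun x => (τ.erase x).image c = Finset.univ.erase i).card := by
  rcases (τ.filter fun x => (τ.erase x).image c = Finset.univ.erase i).eq_empty_or_nonempty with h | h
  · simp [h]
  obtain ⟨x, hx⟩ := h
  obtain ⟨hxτ, hx⟩ := Finset.mem_filter.1 hx
  have hinj : Set.InjOn c (τ.erase x) := by
    rw [← Finset.card_image_iff, hx, Finset.card_erase_of_mem hxτ,
      Finset.card_erase_of_mem (Finset.mem_univ _), hτ, Finset.card_univ]
  have hxi : c x ≠ i := by
    intro h
    apply hc
    rw [← Finset.insert_erase hxτ, Finset.image_insert, hx, h,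
      Finset.insert_erase (Finset.mem_univ _)]
  have : c x ∈ (τ.erase x).image c := by rw [hx]; simp [hxi]
  obtain ⟨x', hx', hcx⟩ := Finset.mem_image.1 this
  obtain ⟨hne, hx'τ⟩ := Finset.mem_erase.1 hx'
  have key : (τ.filter fun x => (τ.erase x).image c = Finset.univ.erase i) = {x, x'} := by
    ext z
    simp only [Finset.mem_filter, Finset.mem_insert, Finset.mem_singleton]
    constructor
    · rintro ⟨hz, hz'⟩
      by_contra! hzz
      have hzx : z ∈ τ.erase x := Finset.mem_erase.2 ⟨hzz.1, hz⟩
      have : c z ∈ Finset.univ.erase i := by rw [← hx]; exact Finset.mem_image_of_mem _ hzx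
      rw [← hz'] at this
      obtain ⟨w, hw, hwz⟩ := Finset.mem_image.1 this
      obtain ⟨hwz', hwτ⟩ := Finset.mem_erase.1 hw
      by_cases hwx : w = x
      · subst hwx
        exact hzz.2 (hinj hzx hx' (by rw [hcx, hwz]))
      · exact hwz' (hinj (Finset.mem_erase.2 ⟨hwx, hwτ⟩) hzx hwz)
    · rintro (rfl | rfl)
      · exact ⟨hxτ, hx⟩
      · refine ⟨hx'τ, ?_⟩
        rw [← hx]
        ext j
        simp only [Finset.mem_image, Finset.mem_erase]
        constructor
        · rintro ⟨a, ⟨ha, haτ⟩, rfl⟩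
          by_cases hax : a = x
          · subst hax; exact ⟨z, ⟨hne, hx'τ⟩, hcx⟩
          · exact ⟨a, ⟨hax, haτ⟩, rfl⟩
        · rintro ⟨a, ⟨ha, haτ⟩, rfl⟩
          by_cases hax : a = z
          · subst hax; exact ⟨x, ⟨Ne.symm hne, hxτ⟩, hcx.symm⟩
          · exact ⟨a, ⟨hax, haτ⟩, rfl⟩
  rw [key, Finset.card_pair (Ne.symm hne)]
  exact even_two

variable [Fintype X]

open scoped Classical in
/-- A dominant set `δ` of size `card I - 1` above whose minima one always finds an element
extends to exactly two dominant sets of size `card I`. -/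
lemma even_card_extensions {r : I → X → ℕ} (hr : ∀ i, Function.Injective (r i))
    {δ : Finset X} (hδ : Dominant r δ) (hne : δ.Nonempty) (hcard : δ.card + 1 = Fintype.card I)
    (hext : ∀ l, ∃ y, ∀ k, k ≠ l → ∃ x ∈ δ, r k x < r k y) :
    Even (Finset.univ.filter fun x => x ∉ δ ∧ Dominant r (insert x δ)).card := by
  choose m hmδ hmin using fun k => Finset.exists_min_image δ (r k) hne
  have hsurj : ∀ x ∈ δ, ∃ k, m k = x := fun x hx => by
    obtain ⟨k, hk⟩ := hδ x
    exact ⟨k, hr k (le_antisymm (hmin k x hx) (hk _ (hmδ k)))⟩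
  obtain ⟨a, -, b, -, hab, hmab⟩ := Finset.exists_ne_map_eq_of_card_lt_of_maps_to
    (s := Finset.univ) (t := δ) (by rw [Finset.card_univ]; omega) (f := m) (fun k _ => hmδ k)
  have himg : (Finset.univ.erase a).image m = δ := by
    ext x
    simp only [Finset.mem_image, Finset.mem_erase, Finset.mem_univ, and_true]
    constructor
    · rintro ⟨k, -, rfl⟩; exact hmδ k
    · intro hx
      obtain ⟨k, rfl⟩ := hsurj x hx
      by_cases hk : k = a
      · exact ⟨b, hab.symm, by rw [hk, hmab]⟩
      · exact ⟨k, hk, rfl⟩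
  have hinj : Set.InjOn m (Finset.univ.erase a : Finset I) := by
    rw [← Finset.card_image_iff, himg, Finset.card_erase_of_mem (Finset.mem_univ _),
      Finset.card_univ]
    omega
  have hpair : ∀ k l, k ≠ l → m k = m l → l = a ∨ l = b := by
    intro k l hkl h
    by_contra! hl
    have hl' : l ∈ Finset.univ.erase a := by simp [hl.1]
    by_cases hk : k = a
    · subst hk
      exact hl.2 (hinj hl' (by simp [hab.symm]) (by rw [← h, hmab]))
    · exact hkl (hinj (by simp [hk]) hl' h)
  let Y : I → Finset X := fun l => Finset.univ.filter fun y => ∀ k, k ≠ l → r k (m k) < r k y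
  have hY : ∀ l y, y ∈ Y l ↔ ∀ k, k ≠ l → r k (m k) < r k y := by simp [Y]
  have hYne : ∀ l, (Y l).Nonempty := fun l => by
    obtain ⟨y, hy⟩ := hext l
    refine ⟨y, (hY l y).2 fun k hk => ?_⟩
    obtain ⟨x, hx, hxy⟩ := hy k hk
    exact (hmin k x hx).trans_lt hxy
  choose M hMY hMmax using fun l => Finset.exists_max_image (Y l) (r l) (hYne l)
  have hYle : ∀ l y, y ∈ Y l → r l y ≤ r l (m l) := fun l y hy => by
    obtain ⟨k, hk⟩ := hδ y
    by_cases hkl : k = l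
    · subst hkl; exact hk _ (hmδ k)
    · exact absurd (hk _ (hmδ k)) (not_le.2 ((hY l y).1 hy k hkl))
  have hdom : ∀ l, Dominant r (insert (M l) δ) := fun l y => by
    by_cases hy : y ∈ Y l
    · refine ⟨l, fun x hx => ?_⟩
      rcases Finset.mem_insert.1 hx with rfl | hx
      · exact hMmax l y hy
      · exact (hYle l y hy).trans (hmin l x hx)
    · rw [hY] at hy
      push Not at hy
      obtain ⟨k, hkl, hk⟩ := hy
      refine ⟨k, fun x hx => ?_⟩
      rcases Finset.mem_insert.1 hx with rfl | hx
      · exact hk.trans ((hY l _).1 (hMY l) k hkl).le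
      · exact hk.trans (hmin k x hx)
  have hMnot : ∀ l l', l ≠ l' → m l = m l' → M l ∉ δ := fun l l' hll h hM => by
    obtain ⟨k, hk⟩ := hsurj _ hM
    by_cases hkl : k = l
    · have := (hY l _).1 (hMY l) l' hll.symm
      rw [← hk, hkl, h] at this
      exact lt_irrefl _ this
    · have := (hY l _).1 (hMY l) k hkl
      rw [hk] at this
      exact lt_irrefl _ this
  have hMab : M a ≠ M b := fun h => by
    obtain ⟨k, hk⟩ := hδ (M a)
    have hk := hk _ (hmδ k)
    by_cases hka : k = a
    · rw [h] at hk
      exact absurd hk (not_le.2 ((hY b _).1 (hMY b) k (hka ▸ hab)))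
    · exact absurd hk (not_le.2 ((hY a _).1 (hMY a) k hka))
  have key : (Finset.univ.filter fun x => x ∉ δ ∧ Dominant r (insert x δ)) = {M a, M b} := by
    ext x
    simp only [Finset.mem_filter, Finset.mem_univ, true_and, Finset.mem_insert,
      Finset.mem_singleton]
    constructor
    · rintro ⟨hx, hd⟩
      obtain ⟨l, hl⟩ := hd x
      have hxl : r l x < r l (m l) :=
        lt_of_le_of_ne (hl _ (Finset.mem_insert_of_mem (hmδ l)))
          fun h => hx (hr l h ▸ hmδ l)
      have hkeep : ∀ y ∈ δ, ∃ k, m k = y ∧ r k (m k) ≤ r k x := fun y hy => by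
        obtain ⟨k, hk⟩ := hd y
        have : m k = y := hr k (le_antisymm (hmin k y hy)
          (hk _ (Finset.mem_insert_of_mem (hmδ k))))
        exact ⟨k, this, this ▸ hk x (Finset.mem_insert_self _ _)⟩
      have hlt : ∀ l, r l x < r l (m l) → (l = a ∨ l = b) := fun l hl => by
        obtain ⟨k, hk, hkx⟩ := hkeep _ (hmδ l)
        refine hpair k l ?_ hk
        rintro rfl
        omega
      have hnot : ¬ (r a x < r a (m a) ∧ r b x < r b (m b)) := fun ⟨h1, h2⟩ => by
        obtain ⟨k, hk, hkx⟩ := hkeep _ (hmδ a)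
        have hka : k ≠ a := by rintro rfl; omega
        have hkb : k ≠ b := by rintro rfl; omega
        have := hpair a k hka.symm hk.symm
        tauto
      have hxY : x ∈ Y l := by
        rw [hY]
        intro k hk
        by_contra! hkx
        have hkx : r k x < r k (m k) := lt_of_le_of_ne hkx fun h => hx (hr k h ▸ hmδ k)
        rcases hlt l hxl with rfl | rfl <;> rcases hlt k hkx with rfl | rfl <;> tauto
      have hxM : x = M l := by
        apply hr l
        refine le_antisymm (hMmax l x hxY) ?_
        obtain ⟨k, hk⟩ := hd (M l)
        by_cases hkl : k = l
        · subst hkl; exact hk x (Finset.mem_insert_self _ _)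
        · exact absurd (hk _ (Finset.mem_insert_of_mem (hmδ k)))
            (not_le.2 ((hY l _).1 (hMY l) k hkl))
      rcases hlt l hxl with rfl | rfl <;> tauto
    · rintro (rfl | rfl)
      · exact ⟨hMnot a b hab hmab, hdom a⟩
      · exact ⟨hMnot b a hab.symm hmab.symm, hdom b⟩
  rw [key, Finset.card_pair hMab]
  exact even_two

open scoped Classical in
/-- Scarf's combinatorial lemma: any coloring fixing the corners `e i` has a dominant set
carrying all colors. -/
theorem exists_dominant_image_eq_univ [Nonempty I] {r : I → X → ℕ}
    (hr : ∀ i, Function.Injective (r i)) {e : I → X}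
    (hlow : ∀ i x, x ≠ e i → r i (e i) < r i x)
    (htop : ∀ i j x, j ≠ i → x ∉ Set.range e → r i x < r i (e j))
    (hT : ∃ x, x ∉ Set.range e) {c : X → I} (hc : ∀ i, c (e i) = i) :
    ∃ τ : Finset X, Dominant r τ ∧ τ.image c = Finset.univ := by
  by_contra! hno
  obtain ⟨i⟩ := ‹Nonempty I›
  have he : Function.Injective e := Function.LeftInverse.injective hc
  have hnpos : 0 < Fintype.card I := Fintype.card_pos_iff.2 ⟨i⟩
  let P : Finset (Finset X × X) := Finset.univ.filter fun p =>
    p.2 ∉ p.1 ∧ Dominant r (insert p.2 p.1) ∧ p.1.image c = Finset.univ.erase i ∧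
      p.1.card + 1 = Fintype.card I
  have hP : ∀ δ x, (δ, x) ∈ P ↔ x ∉ δ ∧ Dominant r (insert x δ) ∧
      δ.image c = Finset.univ.erase i ∧ δ.card + 1 = Fintype.card I := by simp [P]
  have heven : Even P.card := by
    rw [Finset.card_eq_sum_card_fiberwise (f := fun p => insert p.2 p.1) (t := Finset.univ)
      (fun _ _ => Finset.mem_coe.2 (Finset.mem_univ _))]
    refine Finset.even_sum _ fun τ _ => ?_
    by_cases hτ : Dominant r τ ∧ τ.card = Fintype.card I
    · refine (congrArg Even ?_).mpr (even_card_facets (i := i) hτ.2 (hno τ hτ.1))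
      refine Finset.card_bij (fun p _ => p.2) ?_ ?_ ?_
      · rintro ⟨δ, x⟩ hmem
        obtain ⟨h, rfl⟩ := Finset.mem_filter.1 hmem
        rw [hP] at h
        refine Finset.mem_filter.2 ⟨Finset.mem_insert_self _ _, ?_⟩
        simp only [Finset.erase_insert h.1, h.2.2.1]
      · rintro ⟨δ, x⟩ h ⟨δ', x'⟩ h' hxx
        obtain ⟨h, h2⟩ := Finset.mem_filter.1 h
        obtain ⟨h', h2'⟩ := Finset.mem_filter.1 h'
        rw [hP] at h h'
        dsimp only at hxx h2 h2'
        subst hxx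
        rw [← Finset.erase_insert h.1, ← Finset.erase_insert h'.1, h2, h2']
      · intro x hx
        obtain ⟨hxτ, hx⟩ := Finset.mem_filter.1 hx
        refine ⟨(τ.erase x, x), Finset.mem_filter.2 ⟨(hP _ _).2 ?_, Finset.insert_erase hxτ⟩, rfl⟩
        rw [Finset.insert_erase hxτ, Finset.card_erase_of_mem hxτ]
        exact ⟨Finset.notMem_erase _ _, hτ.1, hx, by omega⟩
    · convert Even.zero
      rw [Finset.card_eq_zero, Finset.filter_eq_empty_iff]
      rintro ⟨δ, x⟩ h rfl
      rw [hP] at h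
      exact hτ ⟨h.2.1, by rw [Finset.card_insert_of_notMem h.1, h.2.2.2]⟩
  refine Nat.not_odd_iff_even.2 heven ?_
  set δ₀ : Finset X := (Finset.univ.erase i).image e with hδ₀
  have hfib : ∀ δ : Finset X, δ.image c = Finset.univ.erase i → δ.card + 1 = Fintype.card I →
      (P.filter fun p => p.1 = δ).card =
        (Finset.univ.filter fun x => x ∉ δ ∧ Dominant r (insert x δ)).card := by
    intro δ h1 h2
    refine Finset.card_bij (fun p _ => p.2) ?_ ?_ ?_
    · rintro ⟨δ', x⟩ hmem
      obtain ⟨h, h3⟩ := Finset.mem_filter.1 hmem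
      dsimp only at h3
      subst h3
      rw [hP] at h
      simpa using ⟨h.1, h.2.1⟩
    · rintro ⟨δ', x⟩ h ⟨δ'', x'⟩ h' hxx
      exact Prod.ext ((Finset.mem_filter.1 h).2.trans (Finset.mem_filter.1 h').2.symm) hxx
    · intro x hx
      obtain ⟨-, hx⟩ := Finset.mem_filter.1 hx
      exact ⟨(δ, x), Finset.mem_filter.2 ⟨(hP _ _).2 ⟨hx.1, hx.2, h1, h2⟩, rfl⟩, rfl⟩
  rw [Finset.card_eq_sum_card_fiberwise (f := Prod.fst) (t := Finset.univ)
      (fun _ _ => Finset.mem_coe.2 (Finset.mem_univ _)),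
    ← Finset.add_sum_erase _ _ (Finset.mem_univ δ₀)]
  refine Odd.add_even ?_ (Finset.even_sum _ fun δ hδ => ?_)
  · rw [hfib δ₀ (by ext j; simp [hδ₀, hc]) (by
      rw [hδ₀, Finset.card_image_of_injective _ he,
        Finset.card_erase_of_mem (Finset.mem_univ _), Finset.card_univ]; omega)]
    obtain ⟨t₀, ht₀⟩ := hT
    obtain ⟨M, hM, hMmax⟩ := Finset.exists_max_image
      (Finset.univ.filter fun x => x ∉ Set.range e) (r i) ⟨t₀, by simpa using ht₀⟩
    replace hM : M ∉ Set.range e := (Finset.mem_filter.1 hM).2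
    replace hMmax : ∀ x, x ∉ Set.range e → r i x ≤ r i M := fun x hx =>
      hMmax x (Finset.mem_filter.2 ⟨Finset.mem_univ _, hx⟩)
    have hmem : ∀ x, x ∈ δ₀ ↔ ∃ k, k ≠ i ∧ e k = x := by simp [hδ₀]
    convert odd_one
    rw [Finset.card_eq_one]
    refine ⟨M, ?_⟩
    ext x
    simp only [Finset.mem_filter, Finset.mem_univ, true_and, Finset.mem_singleton]
    constructor
    · rintro ⟨hx, hd⟩
      have hxr : x ∉ Set.range e := by
        rintro ⟨k, rfl⟩
        obtain ⟨l, hl⟩ := hd t₀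
        have hel : e l ∈ insert (e k) δ₀ := by
          by_cases hli : l = i
          · have : k = i := by
              by_contra hki
              exact hx ((hmem _).2 ⟨k, hki, rfl⟩)
            simp [hli, this]
          · exact Finset.mem_insert_of_mem ((hmem _).2 ⟨l, hli, rfl⟩)
        exact absurd (hl _ hel) (not_le.2 (hlow l t₀ fun h => ht₀ ⟨l, h.symm⟩))
      obtain ⟨l, hl⟩ := hd M
      have hli : l = i := by
        by_contra hli
        exact absurd (hl _ (Finset.mem_insert_of_mem ((hmem _).2 ⟨l, hli, rfl⟩)))
          (not_le.2 (hlow l M fun h => hM ⟨l, h.symm⟩))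
      subst hli
      exact hr l (le_antisymm (hMmax x hxr) (hl x (Finset.mem_insert_self _ _)))
    · rintro rfl
      refine ⟨fun h => ?_, fun y => ?_⟩
      · obtain ⟨k, -, hk⟩ := (hmem _).1 h
        exact hM ⟨k, hk⟩
      · by_cases hy : y ∈ Set.range e
        · obtain ⟨k, rfl⟩ := hy
          refine ⟨k, fun z _ => ?_⟩
          by_cases hz : z = e k
          · rw [hz]
          · exact (hlow k z hz).le
        · refine ⟨i, fun z hz => ?_⟩
          rcases Finset.mem_insert.1 hz with rfl | hz
          · exact hMmax y hy
          · obtain ⟨k, hk, rfl⟩ := (hmem _).1 hz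
            exact (htop i k y hk hy).le
  · replace hδ : δ ≠ δ₀ := Finset.ne_of_mem_erase hδ
    by_cases h : δ.image c = Finset.univ.erase i ∧ δ.card + 1 = Fintype.card I
    swap
    · convert Even.zero
      rw [Finset.card_eq_zero, Finset.filter_eq_empty_iff]
      rintro ⟨δ', x⟩ h' rfl
      rw [hP] at h'
      exact h h'.2.2
    rw [hfib δ h.1 h.2]
    by_cases hdom : Dominant r δ
    swap
    · convert Even.zero
      rw [Finset.card_eq_zero, Finset.filter_eq_empty_iff]
      rintro x - hx
      exact hdom (hx.2.mono (Finset.subset_insert _ _))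
    obtain ⟨t, htδ, ht⟩ : ∃ t ∈ δ, t ∉ Set.range e := by
      by_contra! hsub
      apply hδ
      ext x
      simp only [hδ₀, Finset.mem_image]
      constructor
      · intro hx
        obtain ⟨k, rfl⟩ := hsub x hx
        refine ⟨k, ?_, rfl⟩
        rw [← h.1]
        exact Finset.mem_image.2 ⟨_, hx, hc k⟩
      · rintro ⟨k, hk, rfl⟩
        rw [← h.1] at hk
        obtain ⟨x, hx, hxk⟩ := Finset.mem_image.1 hk
        obtain ⟨k', rfl⟩ := hsub x hx
        rw [hc] at hxk
        rwa [← hxk]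
    exact even_card_extensions hr hdom ⟨t, htδ⟩ h.2
      fun l => ⟨e l, fun k hk => ⟨t, htδ, htop k l t hk.symm ht⟩⟩

end Scarf

section Brouwer

variable {I : Type*} [Fintype I]

open Scarf in
/-- Discrete form of Brouwer's theorem on the standard simplex. -/
lemma stdSimplex_exists_almost_le [Nonempty I] {f : (I → ℝ) → I → ℝ}
    (hf : MapsTo f (stdSimplex ℝ I) (stdSimplex ℝ I)) {N : ℕ} (hN : 0 < N) :
    ∃ p ∈ stdSimplex ℝ I, ∀ i, ∃ q ∈ stdSimplex ℝ I,
      (∀ j, |p j - q j| ≤ Fintype.card I / N) ∧ q i - Fintype.card I / N ≤ f q i := by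
  classical
  let T := {k : I → Fin (N + 1) // ∑ i, (k i : ℕ) = N}
  have hNR : (0 : ℝ) < N := by exact_mod_cast hN
  let pt : T → I → ℝ := fun k i => (k.1 i : ℕ) / N
  have hpt : ∀ k, pt k ∈ stdSimplex ℝ I := fun k => by
    refine ⟨fun i => by positivity, ?_⟩
    simp only [pt]
    rw [← Finset.sum_div, ← Nat.cast_sum, k.2, div_self hNR.ne']
  have hcolor : ∀ k, ∃ i, pt k i ≤ f (pt k) i := fun k => by
    by_contra! h
    have := Finset.sum_lt_sum_of_nonempty (s := Finset.univ) Finset.univ_nonempty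
      (fun i _ => h i)
    rw [(hpt k).2, (hf (hpt k)).2] at this
    exact lt_irrefl _ this
  choose col hcol using hcolor
  let M := Fintype.card T
  let enc : T ≃ Fin M := Fintype.equivFin T
  let encI : I ≃ Fin (Fintype.card I) := Fintype.equivFin I
  let r : I → T ⊕ I → ℕ := fun i => Sum.elim (fun k => 1 + ((k.1 i : ℕ) * M + enc k))
    (fun j => if j = i then 0 else 1 + (N + 1) * M + encI j)
  have hrl : ∀ i k, r i (Sum.inl k) = 1 + ((k.1 i : ℕ) * M + enc k) := fun _ _ => rfl
  have hrr : ∀ i j, r i (Sum.inr j) = if j = i then 0 else 1 + (N + 1) * M + encI j :=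
    fun _ _ => rfl
  have hlt : ∀ i k, r i (Sum.inl k) < 1 + (N + 1) * M := fun i k => by
    rw [hrl]
    have h1 : (k.1 i : ℕ) * M ≤ N * M := Nat.mul_le_mul_right _ (by omega)
    have h2 := (enc k).2
    rw [add_mul]
    omega
  have hinj : ∀ i, Function.Injective (r i) := by
    rintro i (k | j) (k' | j') h
    · rw [hrl, hrl] at h
      have h' := congrArg (· % M) (Nat.add_left_cancel h)
      simp only [Nat.mul_add_mod_self_right, Nat.mod_eq_of_lt (enc k).2,
        Nat.mod_eq_of_lt (enc k').2] at h'
      rw [enc.injective (Fin.ext h')]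
    · have := hlt i k
      rw [h, hrr] at this
      have h1 := hrl i k
      rw [h, hrr] at h1
      split_ifs at * <;> omega
    · have := hlt i k'
      rw [← h, hrr] at this
      have h1 := hrl i k'
      rw [← h, hrr] at h1
      split_ifs at * <;> omega
    · rw [hrr, hrr] at h
      split_ifs at h with h1 h2 h2
      · rw [h1, h2]
      · omega
      · omega
      · rw [encI.injective (Fin.ext (Nat.add_left_cancel h))]
  have hle : ∀ i k k', r i (Sum.inl k) ≤ r i (Sum.inl k') → (k.1 i : ℕ) ≤ (k'.1 i : ℕ) := by
    intro i k k' h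
    rw [hrl, hrl] at h
    by_contra! hlt
    have h1 : ((k'.1 i : ℕ) + 1) * M ≤ (k.1 i : ℕ) * M := Nat.mul_le_mul_right _ hlt
    have h2 := (enc k').2
    rw [add_mul] at h1
    omega
  have hvertex : ∀ (g : I → ℕ) (_ : I), ∑ j, g j ≤ N → ∃ k : T, ∀ j, g j ≤ (k.1 j : ℕ) := by
    intro g i hg
    let g' : I → ℕ := g + Pi.single i (N - ∑ j, g j)
    have hg' : ∑ j, g' j = N := by
      simp only [g', Pi.add_apply, Finset.sum_add_distrib, Finset.sum_pi_single', Finset.mem_univ,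
        if_true]
      omega
    have hg'le : ∀ j, g' j < N + 1 := fun j => by
      have := Finset.single_le_sum (f := g') (fun _ _ => Nat.zero_le _) (Finset.mem_univ j)
      omega
    exact ⟨⟨fun j => ⟨g' j, hg'le j⟩, hg'⟩, fun j => Nat.le_add_right _ _⟩
  obtain ⟨k₀, -⟩ := hvertex 0 (Classical.arbitrary I) (by simp)
  obtain ⟨τ, hτ, hτc⟩ := exists_dominant_image_eq_univ hinj (e := Sum.inr)
    (c := Sum.elim col id) (fun i x hx => by
      rw [hrr, if_pos rfl]
      rcases x with k | j
      · rw [hrl]; omega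
      · have : j ≠ i := fun h => hx (by rw [h])
        rw [hrr, if_neg this]; omega)
    (fun i j x hj hx => by
      rcases x with k | j'
      · rw [hrr, if_neg hj]
        exact (hlt i k).trans_le (Nat.le_add_right _ _)
      · exact absurd ⟨j', rfl⟩ hx)
    ⟨Sum.inl k₀, by simp⟩ (fun _ => rfl)
  have hdom : ∀ k : T, ∃ i, Sum.inr i ∉ τ ∧ ∀ k', Sum.inl k' ∈ τ → (k.1 i : ℕ) ≤ (k'.1 i : ℕ) := by
    intro k
    obtain ⟨i, hi⟩ := hτ (Sum.inl k)
    refine ⟨i, fun h => ?_, fun k' hk' => hle i k k' (hi _ hk')⟩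
    have := hi _ h
    rw [hrl, hrr, if_pos rfl] at this
    omega
  have hcolored : ∀ i, Sum.inr i ∉ τ → ∃ k, Sum.inl k ∈ τ ∧ col k = i := by
    intro i hi
    have : i ∈ τ.image (Sum.elim col id) := by rw [hτc]; exact Finset.mem_univ i
    obtain ⟨x, hx, hxi⟩ := Finset.mem_image.1 this
    rcases x with k | j
    · exact ⟨k, hx, hxi⟩
    · exact absurd (show j = i from hxi) (fun h => hi (h ▸ hx))
  obtain ⟨i₀, hi₀, -⟩ := hdom k₀
  obtain ⟨p, hpτ, -⟩ := hcolored i₀ hi₀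
  have hmin : ∀ i, ∃ m : ℕ, (∀ k, Sum.inl k ∈ τ → m ≤ (k.1 i : ℕ)) ∧
      ∃ k, Sum.inl k ∈ τ ∧ m = (k.1 i : ℕ) := by
    intro i
    obtain ⟨k, hk, hk'⟩ := Finset.exists_min_image (Finset.univ.filter fun k : T => Sum.inl k ∈ τ)
      (fun k => (k.1 i : ℕ)) ⟨p, by simpa using hpτ⟩
    exact ⟨k.1 i, fun k' h => hk' k' (by simpa using h), k, by simpa using hk, rfl⟩
  choose m hm hm' using hmin
  let g : I → ℕ := fun i => if Sum.inr i ∉ τ then m i + 1 else 0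
  have hg : N < ∑ i, g i := by
    by_contra! h
    obtain ⟨k, hk⟩ := hvertex g i₀ h
    obtain ⟨i, hi, hik⟩ := hdom k
    obtain ⟨k', hk', hmk⟩ := hm' i
    have h1 := hk i
    have h2 := hik k' hk'
    simp only [g, if_pos hi] at h1
    omega
  have hgle : ∀ k, Sum.inl k ∈ τ → ∀ i, g i ≤ (k.1 i : ℕ) + 1 := by
    intro k hk i
    have := hm i k hk
    simp only [g]
    split_ifs <;> omega
  have hbound : ∀ k, Sum.inl k ∈ τ → ∀ i, (k.1 i : ℕ) + 1 ≤ g i + Fintype.card I := by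
    intro k hk i
    have h1 := k.2
    have h2 : ∑ j ∈ Finset.univ.erase i, g j ≤ ∑ j ∈ Finset.univ.erase i, ((k.1 j : ℕ) + 1) :=
      Finset.sum_le_sum fun j _ => hgle k hk j
    rw [← Finset.add_sum_erase _ _ (Finset.mem_univ i)] at h1 hg
    rw [Finset.sum_add_distrib, Finset.sum_const, Finset.card_erase_of_mem (Finset.mem_univ i),
      Finset.card_univ, smul_eq_mul, mul_one] at h2
    have := Fintype.card_pos (α := I)
    omega
  have hclose : ∀ k k', Sum.inl k ∈ τ → Sum.inl k' ∈ τ → ∀ j,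
      |pt k j - pt k' j| ≤ Fintype.card I / N := by
    intro k k' hk hk' j
    have h1 := hbound k hk j
    have h2 := hgle k hk j
    have h3 := hbound k' hk' j
    have h4 := hgle k' hk' j
    have h5 : ((k.1 j : ℕ) : ℝ) ≤ (k'.1 j : ℕ) + Fintype.card I := by
      exact_mod_cast (by omega : (k.1 j : ℕ) ≤ k'.1 j + Fintype.card I)
    have h6 : ((k'.1 j : ℕ) : ℝ) ≤ (k.1 j : ℕ) + Fintype.card I := by
      exact_mod_cast (by omega : (k'.1 j : ℕ) ≤ k.1 j + Fintype.card I)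
    simp only [pt]
    rw [← sub_div, abs_div, abs_of_pos hNR]
    gcongr
    rw [abs_le]
    constructor <;> linarith
  refine ⟨pt p, hpt p, fun i => ?_⟩
  by_cases hi : Sum.inr i ∈ τ
  · refine ⟨pt p, hpt p, hclose p p hpτ hpτ, ?_⟩
    refine le_trans ?_ ((hf (hpt p)).1 i)
    have h1 := hbound p hpτ i
    simp only [g, not_true, hi, if_false] at h1
    have h2 : ((p.1 i : ℕ) : ℝ) ≤ Fintype.card I := by
      exact_mod_cast (by omega : (p.1 i : ℕ) ≤ Fintype.card I)
    simp only [pt, sub_nonpos]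
    gcongr
  · obtain ⟨q, hq, rfl⟩ := hcolored i hi
    refine ⟨pt q, hpt q, hclose p q hpτ hq, le_trans ?_ (hcol q)⟩
    have : (0 : ℝ) ≤ Fintype.card I / N := by positivity
    linarith

/-- Brouwer's fixed point theorem on the standard simplex. -/
theorem stdSimplex_exists_fixedPoint [Nonempty I] {f : (I → ℝ) → I → ℝ}
    (hfc : ContinuousOn f (stdSimplex ℝ I))
    (hf : MapsTo f (stdSimplex ℝ I) (stdSimplex ℝ I)) :
    ∃ p ∈ stdSimplex ℝ I, f p = p := by
  choose p hp q hq hpq hqf using fun N : ℕ => stdSimplex_exists_almost_le hf N.succ_pos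
  obtain ⟨x, hx, φ, hφ, hlim⟩ := (isCompact_stdSimplex ℝ I).tendsto_subseq hp
  have h0 : Tendsto (fun N : ℕ => (Fintype.card I : ℝ) / (N.succ : ℕ)) atTop (𝓝 0) :=
    (tendsto_const_div_atTop_nhds_zero_nat _).comp (tendsto_add_atTop_nat 1)
  have h0φ := h0.comp hφ.tendsto_atTop
  have hle : ∀ i, x i ≤ f x i := by
    intro i
    have hqx : Tendsto (fun N => q (φ N) i) atTop (𝓝 x) := by
      rw [tendsto_pi_nhds] at hlim ⊢
      intro j
      have : Tendsto (fun N => p (φ N) j - q (φ N) i j) atTop (𝓝 0) :=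
        squeeze_zero_norm (fun N => by simpa using hpq (φ N) i j) h0φ
      simpa using (hlim j).sub this
    have hfq : Tendsto (fun N => f (q (φ N) i)) atTop (𝓝 (f x)) :=
      (hfc x hx).tendsto.comp (tendsto_nhdsWithin_iff.2
        ⟨hqx, Eventually.of_forall fun N => hq _ _⟩)
    have h1 := (tendsto_pi_nhds.1 hqx i).sub h0φ
    rw [sub_zero] at h1
    exact le_of_tendsto_of_tendsto' h1 (tendsto_pi_nhds.1 hfq i) fun N => hqf (φ N) i
  refine ⟨x, hx, ?_⟩
  have hsum : ∑ i, x i = ∑ i, f x i := by rw [hx.2, (hf hx).2]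
  have := (Finset.sum_eq_sum_iff_of_le fun i _ => hle i).1 hsum
  exact funext fun i => (this i (Finset.mem_univ i)).symm

end Brouwer

section Selection

variable {X E : Type*} [TopologicalSpace X] [NormedAddCommGroup E]

lemma LscAt.inter_ball {Φ : X → Set E} {f : X → E} {x : X} (h : LscAt Φ x)
    (hf : ContinuousAt f x) (δ : ℝ) : LscAt (fun z => Φ z ∩ Metric.ball (f z) δ) x := by
  rintro Ω hΩ ⟨y, ⟨hy, hyf⟩, hyΩ⟩
  obtain ⟨s, hys, hsδ⟩ := exists_between (Metric.mem_ball.1 hyf)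
  filter_upwards [h (Ω ∩ Metric.ball (f x) s) (hΩ.inter Metric.isOpen_ball) ⟨y, hy, hyΩ, hys⟩,
    Metric.continuousAt_iff'.1 hf (δ - s) (sub_pos.2 hsδ)] with z hz hfz
  obtain ⟨w, hw, hwΩ, hws⟩ := hz
  refine ⟨w, ⟨hw, ?_⟩, hwΩ⟩
  rw [Metric.mem_ball] at hws ⊢
  have := dist_triangle_right w (f z) (f x)
  linarith

variable [NormedSpace ℝ E]

lemma exists_continuousMap_dist_lt_of_lsc [NormalSpace X] [ParacompactSpace X] {Φ : X → Set E}
    (hl : ∀ x, LscAt Φ x) (hne : ∀ x, (Φ x).Nonempty) (hc : ∀ x, Convex ℝ (Φ x))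
    {ε : ℝ} (hε : 0 < ε) : ∃ g : C(X, E), ∀ x, ∃ y ∈ Φ x, dist (g x) y < ε := by
  obtain ⟨g, hg⟩ := exists_continuous_forall_mem_convex_of_local_const
    (t := fun x => Metric.thickening ε (Φ x)) (fun x => (hc x).thickening ε) (fun x => by
      obtain ⟨y, hy⟩ := hne x
      refine ⟨y, ?_⟩
      filter_upwards [hl x (Metric.ball y ε) Metric.isOpen_ball
        ⟨y, hy, Metric.mem_ball_self hε⟩] with z ⟨w, hw, hwy⟩
      exact Metric.mem_thickening_iff.2 ⟨w, hw, by rwa [dist_comm]⟩)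
  exact ⟨g, fun x => Metric.mem_thickening_iff.1 (hg x)⟩

/-- Michael's selection theorem on a compact space, for the closures of the values. -/
theorem exists_continuousMap_mem_closure_of_lsc [CompactSpace X] [T2Space X] [CompleteSpace E]
    {Φ : X → Set E} (hl : ∀ x, LscAt Φ x) (hne : ∀ x, (Φ x).Nonempty)
    (hc : ∀ x, Convex ℝ (Φ x)) : ∃ g : C(X, E), ∀ x, g x ∈ closure (Φ x) := by
  let S : ℕ → Set C(X, E) := fun n => {g | ∀ x, ∃ y ∈ Φ x, dist (g x) y < (1 / 2) ^ n}
  have step : ∀ n (g : S n), ∃ g' : S (n + 1),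
      dist (g : C(X, E)) g' ≤ 2 * (1 / 2) ^ n := by
    rintro n ⟨g, hg⟩
    obtain ⟨g', hg'⟩ := exists_continuousMap_dist_lt_of_lsc
      (Φ := fun z => Φ z ∩ Metric.ball (g z) ((1 / 2) ^ n))
      (fun x => (hl x).inter_ball g.continuous.continuousAt _)
      (fun x => by
        obtain ⟨y, hy, hgy⟩ := hg x
        exact ⟨y, hy, by rwa [Metric.mem_ball, dist_comm]⟩)
      (fun x => (hc x).inter (convex_ball _ _))
      (show (0 : ℝ) < (1 / 2) ^ (n + 1) by positivity)
    refine ⟨⟨g', fun x => ?_⟩, (ContinuousMap.dist_le (by positivity)).2 fun x => ?_⟩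
    · obtain ⟨y, hy, h⟩ := hg' x
      exact ⟨y, hy.1, h⟩
    · obtain ⟨y, hy, h⟩ := hg' x
      have h1 := Metric.mem_ball.1 hy.2
      have h2 := dist_triangle_left (g x) (g' x) y
      rw [dist_comm y (g' x)] at h2
      have h3 : (1 / 2 : ℝ) ^ (n + 1) ≤ (1 / 2) ^ n :=
        pow_le_pow_of_le_one (by norm_num) (by norm_num) n.le_succ
      show dist (g x) (g' x) ≤ _
      linarith
  choose next hnext using step
  obtain ⟨g₀, hg₀⟩ := exists_continuousMap_dist_lt_of_lsc hl hne hc one_pos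
  have hg₀S : g₀ ∈ S 0 := by simpa [S] using hg₀
  obtain ⟨u, hu⟩ : ∃ u : ∀ n, S n, ∀ n, u (n + 1) = next n (u n) :=
    ⟨fun n => Nat.rec (motive := fun n => S n) ⟨g₀, hg₀S⟩ next n, fun n => rfl⟩
  replace hu : ∀ n, dist (u n : C(X, E)) (u (n + 1)) ≤ 2 * (1 / 2) ^ n := fun n => by
    rw [hu]; exact hnext n (u n)
  obtain ⟨g, hg⟩ := cauchySeq_tendsto_of_complete
    (cauchySeq_of_le_geometric (1 / 2) 2 (by norm_num) hu)
  refine ⟨g, fun x => ?_⟩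
  have hgx : Tendsto (fun n => (u n : C(X, E)) x) atTop (𝓝 (g x)) :=
    ((continuous_eval_const x).tendsto g).comp hg
  choose y hy hyu using fun n => (u n).2 x
  refine mem_closure_of_tendsto (f := y) (b := atTop) ?_ (Eventually.of_forall hy)
  have h0 : Tendsto (fun n : ℕ => (1 / 2 : ℝ) ^ n) atTop (𝓝 0) :=
    tendsto_pow_atTop_nhds_zero_of_lt_one (by norm_num) (by norm_num)
  exact tendsto_of_tendsto_of_dist hgx (squeeze_zero (fun _ => dist_nonneg)
    (fun n => (hyu n).le) h0)

end Selection

/-- Proper separation of a point from a nonempty convex set in finite dimension. -/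
theorem Convex.exists_properly_separating {E : Type*} [NormedAddCommGroup E] [NormedSpace ℝ E]
    [FiniteDimensional ℝ E] {s : Set E} (hs : Convex ℝ s) (hne : s.Nonempty) {x : E}
    (hx : x ∉ s) : ∃ p : E →L[ℝ] ℝ, (∀ y ∈ s, p y ≤ p x) ∧ ∃ y ∈ s, p y < p x := by
  let V : Submodule ℝ E := Submodule.span ℝ ((fun y => y - x) '' s)
  have hV : ∀ y ∈ s, y - x ∈ V := fun y hy => Submodule.subset_span ⟨y, hy, rfl⟩
  let T : Set V := {v | ∃ t : ℝ, 0 < t ∧ ∃ y ∈ s, (v : E) = t • (y - x)}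
  have hT : Convex ℝ T := by
    rintro v ⟨t, ht, y, hy, hv⟩ w ⟨t', ht', z, hz, hw⟩ a b ha hb hab
    have hu : 0 < a * t + b * t' := by
      rcases ha.eq_or_lt with rfl | ha
      · have : b = 1 := by linarith
        subst this; linarith
      · have := mul_pos ha ht
        have := mul_nonneg hb ht'.le
        linarith
    refine ⟨a * t + b * t', hu, (a * t / (a * t + b * t')) • y + (b * t' / (a * t + b * t')) • z,
      hs hy hz (by positivity) (by positivity) (by field_simp), ?_⟩
    rw [smul_sub, smul_add, smul_smul, smul_smul, mul_div_cancel₀ _ hu.ne',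
      mul_div_cancel₀ _ hu.ne']
    push_cast
    rw [hv, hw]
    module
  have hT0 : (0 : V) ∉ T := by
    rintro ⟨t, ht, y, hy, h⟩
    rcases smul_eq_zero.1 h.symm with h | h
    · exact ht.ne' h
    · exact hx (sub_eq_zero.1 h ▸ hy)
  have hTne : T.Nonempty := by
    obtain ⟨y, hy⟩ := hne
    exact ⟨⟨y - x, hV y hy⟩, 1, one_pos, y, hy, (one_smul _ _).symm⟩
  have hspan : Submodule.span ℝ T = ⊤ := by
    rw [eq_top_iff, ← Submodule.span_span_coe_preimage (R := ℝ) (s := (fun y => y - x) '' s)]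
    refine Submodule.span_mono ?_
    rintro v ⟨y, hy, hv⟩
    exact ⟨1, one_pos, y, hy, by rw [one_smul]; exact hv.symm⟩
  have hint : (interior T).Nonempty := by
    rw [hT.interior_nonempty_iff_affineSpan_eq_top,
      AffineSubspace.affineSpan_eq_top_iff_vectorSpan_eq_top_of_nonempty ℝ V V hTne,
      eq_top_iff, ← hspan, Submodule.span_le]
    rintro v ⟨t, ht, y, hy, hv⟩
    have h2 : (2 : ℝ) • v ∈ T := ⟨2 * t, by positivity, y, hy, by
      rw [Submodule.coe_smul, hv, smul_smul]⟩
    have := vsub_mem_vectorSpan ℝ h2 (show v ∈ T from ⟨t, ht, y, hy, hv⟩)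
    rwa [vsub_eq_sub, two_smul, add_sub_cancel_right] at this
  obtain ⟨q, hq⟩ := geometric_hahn_banach_open_point hT.interior isOpen_interior
    (fun h => hT0 (interior_subset h))
  obtain ⟨p, hp⟩ := LinearMap.exists_extend (q : V →ₗ[ℝ] ℝ)
  have hpq : ∀ v : V, p v = q v := fun v => LinearMap.congr_fun hp v
  have hqT : ∀ v ∈ T, q v ≤ 0 := fun v hv => by
    have : v ∈ closure (interior T) := by
      rw [hT.closure_interior_eq_closure_of_nonempty_interior hint]
      exact subset_closure hv
    refine closure_minimal (t := {v | q v ≤ 0}) (fun w hw => ?_)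
      (isClosed_le q.continuous continuous_const) this
    simpa using (hq w hw).le
  refine ⟨LinearMap.toContinuousLinearMap p, fun y hy => ?_, ?_⟩
  · have := hqT ⟨y - x, hV y hy⟩ ⟨1, one_pos, y, hy, (one_smul _ _).symm⟩
    rw [← hpq, map_sub] at this
    simpa using this
  · obtain ⟨v, hv⟩ := hint
    obtain ⟨t, ht, y, hy, hvt⟩ := interior_subset hv
    have := hq v hv
    rw [map_zero, ← hpq, hvt, map_smul, smul_eq_mul, map_sub] at this
    refine ⟨y, hy, ?_⟩
    show p y < p x
    by_contra! h
    exact absurd this (not_lt.2 (mul_nonneg ht.le (sub_nonneg.2 h)))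

/-- Michael's selection theorem for finite-dimensional convex values, not necessarily closed,
on a compact metrizable space. -/
theorem exists_continuousMap_mem_of_lsc {X E : Type*} [PseudoEMetricSpace X] [CompactSpace X]
    [T2Space X] [NormedAddCommGroup E] [NormedSpace ℝ E] [FiniteDimensional ℝ E] {Φ : X → Set E}
    (hl : ∀ x, LscAt Φ x) (hne : ∀ x, (Φ x).Nonempty) (hc : ∀ x, Convex ℝ (Φ x)) :
    ∃ g : C(X, E), ∀ x, g x ∈ Φ x := by
  classical
  have : CompleteSpace E := FiniteDimensional.complete ℝ E
  have : SecondCountableTopology E := secondCountable_of_proper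
  -- a sequence of selections with dense values
  have hU : ∀ j : ℕ × ℕ, IsOpen {x | (Φ x ∩ Metric.ball (TopologicalSpace.denseSeq E j.1)
      (1 / (j.2 + 1 : ℝ))).Nonempty} := fun j =>
    isOpen_iff_mem_nhds.2 fun x hx => hl x _ Metric.isOpen_ball hx
  choose A hAcl hAsub hAU _ using fun j => (hU j).exists_iUnion_isClosed
  have hsel : ∀ a : (ℕ × ℕ) × ℕ, ∃ g : C(X, E), (∀ x, g x ∈ closure (Φ x)) ∧
      ∀ x ∈ A a.1 a.2, g x ∈ Metric.closedBall (TopologicalSpace.denseSeq E a.1.1)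
        (1 / (a.1.2 + 1 : ℝ)) := by
    intro a
    let B := Metric.ball (TopologicalSpace.denseSeq E a.1.1) (1 / (a.1.2 + 1 : ℝ))
    obtain ⟨g, hg⟩ := exists_continuousMap_mem_closure_of_lsc
      (Φ := fun x => if x ∈ A a.1 a.2 then Φ x ∩ B else Φ x) (fun x Ω hΩ hx => by
        dsimp only at hx ⊢
        by_cases hxA : x ∈ A a.1 a.2
        · rw [if_pos hxA, inter_assoc] at hx
          filter_upwards [hl x (B ∩ Ω) (Metric.isOpen_ball.inter hΩ) hx] with z ⟨w, h1, h2, h3⟩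
          refine ⟨w, ?_, h3⟩
          split_ifs
          exacts [⟨h1, h2⟩, h1]
        · rw [if_neg hxA] at hx
          filter_upwards [hl x Ω hΩ hx, (hAcl a.1 a.2).isOpen_compl.mem_nhds hxA] with z hz hzA
          rwa [if_neg hzA])
      (fun x => by
        split_ifs with h
        exacts [hAsub a.1 a.2 h, hne x])
      (fun x => by
        split_ifs
        exacts [(hc x).inter (convex_ball _ _), hc x])
    refine ⟨g, fun x => ?_, fun x hx => ?_⟩
    · refine closure_mono ?_ (hg x)
      split_ifs
      exacts [inter_subset_left, subset_rfl]
    · have := hg x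
      rw [if_pos hx] at this
      exact Metric.closure_ball_subset_closedBall (closure_mono inter_subset_right this)
  choose h hcl hball using hsel
  obtain ⟨φ, hφ⟩ := exists_surjective_nat ((ℕ × ℕ) × ℕ)
  -- a weighted average of all of them
  let w : ℕ → ℝ := fun k => (1 / 2) ^ k / (1 + ‖h (φ k)‖)
  have hw : ∀ k, 0 < w k := fun k => by positivity
  have hwle : ∀ k, w k ≤ (1 / 2) ^ k := fun k =>
    div_le_self (by positivity) (le_add_of_nonneg_right (norm_nonneg _))
  have hgeom : Summable fun k : ℕ => (1 / 2 : ℝ) ^ k :=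
    summable_geometric_of_lt_one (by norm_num) (by norm_num)
  have hws : Summable w := Summable.of_nonneg_of_le (fun k => (hw k).le) hwle hgeom
  have hhs : Summable fun k => w k • h (φ k) := by
    refine Summable.of_norm_bounded hgeom fun k => ?_
    rw [norm_smul, Real.norm_of_nonneg (hw k).le, div_mul_eq_mul_div]
    rw [div_le_iff₀ (by positivity)]
    gcongr
    linarith
  have hW : 0 < ∑' k, w k := hws.tsum_pos (fun k => (hw k).le) 0 (hw 0)
  set W := ∑' k, w k with hWdef
  let g : C(X, E) := W⁻¹ • ∑' k, w k • h (φ k)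
  have hgsum : ∀ x (p : E →L[ℝ] ℝ), HasSum (fun k => w k * p (h (φ k) x)) (W * p (g x)) := by
    intro x p
    have h1 := (hhs.hasSum.map (ContinuousMap.evalCLM ℝ x) (ContinuousMap.evalCLM ℝ x).continuous)
    have h2 := h1.map p p.continuous
    have h3 : W * p (g x) = p (ContinuousMap.evalCLM ℝ x (∑' k, w k • h (φ k))) := by
      simp [g, hW.ne']
    rw [h3]
    convert h2 using 2 with k
    simp
  refine ⟨g, fun x => ?_⟩
  by_contra hx
  obtain ⟨p, hp, y, hy, hyp⟩ := (hc x).exists_properly_separating (hne x) hx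
  have hple : ∀ k, p (h (φ k) x) ≤ p (g x) := fun k =>
    closure_minimal (t := {z | p z ≤ p (g x)}) hp
      (isClosed_le p.continuous continuous_const) (hcl _ x)
  have hzero : HasSum (fun k => w k * (p (g x) - p (h (φ k) x))) 0 := by
    have := (hws.hasSum.mul_right (p (g x))).sub (hgsum x p)
    simpa only [mul_sub, ← hWdef, sub_self] using this
  have heq : ∀ k, p (h (φ k) x) = p (g x) := fun k => by
    have := congrFun ((hasSum_zero_iff_of_nonneg
      (fun k => mul_nonneg (hw k).le (sub_nonneg.2 (hple k)))).1 hzero) k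
    have := (mul_eq_zero.1 this).resolve_left (hw k).ne'
    linarith
  obtain ⟨ε, hε, hball'⟩ := Metric.isOpen_iff.1
    (isOpen_lt p.continuous (continuous_const (y := p (g x)))) y hyp
  obtain ⟨r, hr⟩ := exists_nat_one_div_lt (half_pos hε)
  have hr0 : (0 : ℝ) < 1 / (r + 1 : ℝ) := by positivity
  obtain ⟨m, hm⟩ := (TopologicalSpace.denseRange_denseSeq E).exists_dist_lt y hr0
  have hxU : x ∈ ⋃ j, A (m, r) j := by
    rw [hAU (m, r)]
    exact ⟨y, hy, hm⟩
  obtain ⟨j, hj⟩ := mem_iUnion.1 hxU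
  obtain ⟨k, hk⟩ := hφ ((m, r), j)
  have hb : dist (h ((m, r), j) x) (TopologicalSpace.denseSeq E m) ≤ 1 / (r + 1 : ℝ) :=
    Metric.mem_closedBall.1 (hball ((m, r), j) x hj)
  rw [← hk] at hb
  have hlt : p (h (φ k) x) < p (g x) := hball' (by
    rw [Metric.mem_ball]
    have := dist_triangle_right (h (φ k) x) y (TopologicalSpace.denseSeq E m)
    linarith)
  exact hlt.ne (heq k)

section FixedPoint

variable {n : ℕ} {C : Set (Fin n → ℝ)}

/-- Brouwer's fixed point theorem on a nonempty compact convex set. -/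
theorem exists_fixedPoint_of_compact_convex (hne : C.Nonempty) (hconv : Convex ℝ C)
    (hcomp : IsCompact C) (h : C(C, C)) : ∃ x, h x = x := by
  classical
  obtain ⟨R, hR, hCR⟩ : ∃ R : ℝ, 0 < R ∧ ∀ y ∈ C, ∀ i, |y i| ≤ R := by
    obtain ⟨R, hR⟩ := hcomp.isBounded.exists_norm_le
    refine ⟨max R 1, by positivity, fun y hy i => ?_⟩
    exact (norm_le_pi_norm y i).trans ((hR y hy).trans (le_max_left _ _))
  have ha : (0 : ℝ) < 2 * R * (n + 1) := by positivity
  -- affine coordinates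
  let L : (Option (Fin n) → ℝ) → Fin n → ℝ := fun z i => 2 * R * (n + 1) * z (some i) - R
  have hL : Continuous L := by fun_prop
  let b : (Fin n → ℝ) → Fin n → ℝ := fun y i => (y i + R) / (2 * R * (n + 1))
  let e : (Fin n → ℝ) → Option (Fin n) → ℝ := fun y o => o.elim (1 - ∑ i, b y i) (b y)
  have he : Continuous e := by
    refine continuous_pi fun o => ?_
    cases o with
    | none => simp only [e, b, Option.elim_none]; fun_prop
    | some i => simp only [e, b, Option.elim_some]; fun_prop
  have hLe : ∀ y, L (e y) = y := fun y => by
    ext i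
    simp only [L, e, b, Option.elim_some]
    field_simp
    ring
  have heC : ∀ y ∈ C, e y ∈ stdSimplex ℝ (Option (Fin n)) := by
    intro y hy
    have h0 : ∀ i, 0 ≤ b y i := fun i => by
      have := (abs_le.1 (hCR y hy i)).1
      exact div_nonneg (by linarith) ha.le
    have h1 : ∀ i, b y i ≤ 1 / (n + 1) := fun i => by
      have := (abs_le.1 (hCR y hy i)).2
      rw [div_le_div_iff₀ ha (by positivity)]
      have h3 : (0 : ℝ) < n + 1 := by positivity
      nlinarith
    have h2 : ∑ i, b y i ≤ 1 := by
      refine (Finset.sum_le_sum fun i _ => h1 i).trans ?_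
      rw [Finset.sum_const, Finset.card_univ, Fintype.card_fin, nsmul_eq_mul, mul_one_div,
        div_le_one (by positivity)]
      linarith
    refine ⟨fun o => ?_, ?_⟩
    · cases o with
      | none => simpa [e] using h2
      | some i => exact h0 i
    · rw [Fintype.sum_option]
      simp [e]
  have : CompactSpace (stdSimplex ℝ (Option (Fin n))) :=
    isCompact_iff_compactSpace.1 (isCompact_stdSimplex ℝ _)
  -- a continuous map into `C` agreeing with `L` on the preimage of `C`
  obtain ⟨ρ, hρ⟩ := exists_continuousMap_mem_of_lsc
    (X := stdSimplex ℝ (Option (Fin n))) (Φ := fun z => if L z ∈ C then {L z} else C)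
    (fun z Ω hΩ hz => by
      dsimp only at hz ⊢
      have hLz : Continuous fun z : stdSimplex ℝ (Option (Fin n)) => L z :=
        hL.comp continuous_subtype_val
      by_cases hzC : L z ∈ C
      · rw [if_pos hzC] at hz
        obtain ⟨_, rfl, hzΩ⟩ := hz
        filter_upwards [hLz.continuousAt.preimage_mem_nhds (hΩ.mem_nhds hzΩ)] with z' hz'
        split_ifs
        exacts [⟨_, rfl, hz'⟩, ⟨_, hzC, hzΩ⟩]
      · rw [if_neg hzC] at hz
        filter_upwards [hLz.continuousAt.preimage_mem_nhds
          (hcomp.isClosed.isOpen_compl.mem_nhds hzC)] with z' hz'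
        rwa [if_neg hz'])
    (fun z => by
      split_ifs
      exacts [singleton_nonempty _, hne])
    (fun z => by
      split_ifs
      exacts [convex_singleton _, hconv])
  have hρC : ∀ z, ρ z ∈ C := fun z => by
    have := hρ z
    split_ifs at this with hz
    · rwa [mem_singleton_iff.1 this]
    · exact this
  have hρL : ∀ z : stdSimplex ℝ (Option (Fin n)), L z ∈ C → ρ z = L z := fun z hz => by
    have := hρ z
    rwa [if_pos hz] at this
  let F : stdSimplex ℝ (Option (Fin n)) → Option (Fin n) → ℝ := fun z => e (h ⟨ρ z, hρC z⟩)
  have hF : Continuous F := he.comp (continuous_subtype_val.comp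
    (h.continuous.comp (ρ.continuous.subtype_mk hρC)))
  let f : (Option (Fin n) → ℝ) → Option (Fin n) → ℝ := fun z =>
    if hz : z ∈ stdSimplex ℝ (Option (Fin n)) then F ⟨z, hz⟩ else z
  have hfF : ∀ z (hz : z ∈ stdSimplex ℝ (Option (Fin n))), f z = F ⟨z, hz⟩ :=
    fun z hz => dif_pos hz
  obtain ⟨z, hz, hfz⟩ := stdSimplex_exists_fixedPoint (f := f)
    (by
      rw [continuousOn_iff_continuous_domRestrict]
      convert hF using 1
      exact funext fun z => hfF z z.2)
    (fun z hz => by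
      rw [hfF z hz]
      exact heC _ (h _).2)
  rw [hfF z hz] at hfz
  have hLz : L z = h ⟨ρ ⟨z, hz⟩, hρC _⟩ := by
    conv_lhs => rw [← hfz]
    exact hLe _
  refine ⟨⟨ρ ⟨z, hz⟩, hρC _⟩, Subtype.ext ?_⟩
  rw [← hLz]
  exact (hρL ⟨z, hz⟩ (show L z ∈ C by rw [hLz]; exact (h _).2)).symm

/-- A lower semicontinuous set-valued self-map of a compact convex set with nonempty convex
values has a fixed point. -/
theorem exists_mem_self_of_lsc (hne : C.Nonempty) (hconv : Convex ℝ C) (hcomp : IsCompact C)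
    {Φ : C → Set C} (hl : ∀ x, LscAt Φ x) (hΦne : ∀ x, (Φ x).Nonempty)
    (hΦ : ∀ x, Convex ℝ (Subtype.val '' Φ x)) : ∃ x, x ∈ Φ x := by
  have : CompactSpace C := isCompact_iff_compactSpace.1 hcomp
  obtain ⟨g, hg⟩ := exists_continuousMap_mem_of_lsc (Φ := fun x => Subtype.val '' Φ x)
    (fun x Ω hΩ hx => by
      obtain ⟨_, ⟨y, hy, rfl⟩, hyΩ⟩ := hx
      filter_upwards [hl x _ (hΩ.preimage continuous_subtype_val) ⟨y, hy, hyΩ⟩] with z ⟨w, hw, hwΩ⟩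
      exact ⟨w, ⟨w, hw, rfl⟩, hwΩ⟩)
    (fun x => (hΦne x).image _) hΦ
  choose s hs hsg using hg
  obtain ⟨x, hx⟩ := exists_fixedPoint_of_compact_convex hne hconv hcomp
    ⟨s, continuous_induced_rng.2 (g.continuous.congr fun x => (hsg x).symm)⟩
  exact ⟨x, by simpa [show s x = x from hx] using hs x⟩

end FixedPoint

/-- Localization of solutions (Remark 3.2): under the hypotheses of the main existence
theorem, the quasiequilibrium problem has a solution `x` which moreover lies on the
boundary `∂_C fix K` or belongs to `int_C fix K` and solves the equilibrium problem
on all of `C`. -/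
theorem quasiequilibrium_existence_localized {n : ℕ} {C : Set (Fin n → ℝ)}
    (hCne : C.Nonempty) (hCconv : Convex ℝ C) (hCcomp : IsCompact C)
    (f : C → C → ℝ) (hdiag : ∀ x : C, f x x = 0)
    (K : C → Set C)
    (hKlsc : ∀ x : C, LscAt K x)
    (hKne : ∀ x : C, (K x).Nonempty)
    (hKconv : ∀ x : C, Convex ℝ (Subtype.val '' K x))
    (hfix : IsClosed {x : C | x ∈ K x})
    (F : C → Set C) (hF : ∀ x : C, F x = {y : C | f x y < 0})
    (hFconv : ∀ x ∈ {x : C | x ∈ K x}, Convex ℝ (Subtype.val '' F x))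
    (hFlsc : ∀ x ∈ {x : C | x ∈ K x}, LscAt F x)
    (hFKlsc : ∀ x ∈ frontier {x : C | x ∈ K x}, LscAt (fun z => F z ∩ K z) x) :
    ∃ x : C, (x ∈ K x ∧ ∀ y ∈ K x, 0 ≤ f x y) ∧
      (x ∈ frontier {x : C | x ∈ K x} ∨
        (x ∈ interior {x : C | x ∈ K x} ∧ ∀ y : C, 0 ≤ f x y)) := by
  classical
  by_contra! hno
  set S : Set C := {x : C | x ∈ K x} with hS
  have hint : ∀ x ∈ S, x ∉ frontier S → x ∈ interior S := fun x hx hxf => by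
    by_contra h
    exact hxf ⟨subset_closure hx, h⟩
  have hfr : frontier S ⊆ S := hfix.frontier_subset
  let G : C → Set C := fun x => if x ∈ S then if x ∈ frontier S then F x ∩ K x else F x else K x
  have hGout : ∀ x, x ∉ S → G x = K x := fun x hx => if_neg hx
  have hGfr : ∀ x, x ∈ frontier S → G x = F x ∩ K x := fun x hx => by
    simp only [G, if_pos (hfr hx), if_pos hx]
  have hGint : ∀ x, x ∈ interior S → G x = F x := fun x hx => by
    simp only [G, if_pos (interior_subset hx), if_neg fun h : x ∈ frontier S => h.2 hx]
  have hGsup : ∀ x, F x ∩ K x ⊆ G x := fun x => by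
    simp only [G]
    split_ifs
    exacts [subset_rfl, inter_subset_left, inter_subset_right]
  have hcases : ∀ x, x ∉ S ∨ x ∈ frontier S ∨ x ∈ interior S := fun x => by
    have := hint x
    tauto
  obtain ⟨x, hx⟩ := exists_mem_self_of_lsc hCne hCconv hCcomp (Φ := G)
    (fun x Ω hΩ hx => by
      rcases hcases x with h | h | h
      · rw [hGout x h] at hx
        filter_upwards [hKlsc x Ω hΩ hx, hfix.isOpen_compl.mem_nhds h] with z hz hzS
        rwa [hGout z hzS]
      · rw [hGfr x h] at hx
        filter_upwards [hFKlsc x h Ω hΩ hx] with z hz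
        exact hz.mono (inter_subset_inter_left _ (hGsup z))
      · rw [hGint x h] at hx
        filter_upwards [hFlsc x (interior_subset h) Ω hΩ hx,
          isOpen_interior.mem_nhds h] with z hz hzS
        rwa [hGint z hzS])
    (fun x => by
      rcases hcases x with h | h | h
      · rw [hGout x h]
        exact hKne x
      · rw [hGfr x h]
        by_contra hemp
        refine (hno x ⟨hfr h, fun y hy => ?_⟩).1 h
        by_contra! hlt
        exact hemp ⟨y, by rw [hF]; exact hlt, hy⟩
      · rw [hGint x h]
        by_contra hemp
        have hpos : ∀ y, 0 ≤ f x y := fun y => by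
          by_contra! hlt
          exact hemp ⟨y, by rw [hF]; exact hlt⟩
        obtain ⟨y, hy⟩ := (hno x ⟨show x ∈ S from interior_subset h, fun y _ => hpos y⟩).2 h
        exact absurd hy (not_lt.2 (hpos y)))
    (fun x => by
      rcases hcases x with h | h | h
      · rw [hGout x h]
        exact hKconv x
      · rw [hGfr x h, image_inter Subtype.val_injective]
        exact (hFconv x (hfr h)).inter (hKconv x)
      · rw [hGint x h]
        exact hFconv x (interior_subset h))
  have hxF : x ∉ F x := by simp [hF, hdiag]
  rcases hcases x with h | h | h
  · rw [hGout x h] at hx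
    exact h hx
  · rw [hGfr x h] at hx
    exact hxF hx.1
  · rw [hGint x h] at hx
    exact hxF hx
end

section
/- Let X and Y be topological spaces and Φ₁, Φ₂ : X ⇉ Y set-valued maps. If the graph of Φ₁, i.e. gph Φ₁ := {(x,y) ∈ X × Y : y ∈ Φ₁(x)}, is open in X × Y and Φ₂ is lower semicontinuous, then the intersection map x ↦ Φ₁(x) ∩ Φ₂(x) is lower semicontinuous. -/
open Set Topology Filter

/-- Proposition 3.1: if `Φ₁` has open graph and `Φ₂` is lower semicontinuous, then the
intersection map `x ↦ Φ₁ x ∩ Φ₂ x` is lower semicontinuous. -/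
theorem lsc_inter_of_openGraph {X Y : Type*} [TopologicalSpace X] [TopologicalSpace Y]
    (Φ₁ Φ₂ : X → Set Y)
    (hgraph : IsOpen {p : X × Y | p.2 ∈ Φ₁ p.1})
    (hlsc : ∀ x : X, LscAt Φ₂ x) :
    ∀ x : X, LscAt (fun z => Φ₁ z ∩ Φ₂ z) x := by
  rintro x Ω hΩ ⟨y, ⟨hy₁, hy₂⟩, hyΩ⟩
  obtain ⟨U, V, hU, hV, hxU, hyV, hUV⟩ := isOpen_prod_iff.1 hgraph x y hy₁
  filter_upwards [hU.mem_nhds hxU, hlsc x (Ω ∩ V) (hΩ.inter hV) ⟨y, hy₂, hyΩ, hyV⟩]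
    with x' hx' ⟨z, hz₂, hzΩ, hzV⟩
  exact ⟨z, ⟨hUV (mk_mem_prod hx' hzV), hz₂⟩, hzΩ⟩
end

section
/- Let X be a topological space, C ⊆ ℝ^n, and Φ₁, Φ₂ : X ⇉ C lower semicontinuous set-valued maps with convex values. Assume that for every x ∈ X the affine hull of Φ₂(x) equals the affine hull of C, and that Φ₁(x) ∩ Φ₂(x) ≠ ∅ implies Φ₁(x) ∩ ri Φ₂(x) ≠ ∅, where ri denotes the relative interior (the interior within the affine hull). Then the intersection map x ↦ Φ₁(x) ∩ Φ₂(x) is lower semicontinuous. -/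
open Set Topology Filter

theorem ball_subset_of_forall_exists_dist_lt {V : Type*} [NormedAddCommGroup V]
    [NormedSpace ℝ V] {K : Set V} (hK : Convex ℝ K) (hKc : IsClosed K) {r δ : ℝ} (hδ : 0 < δ)
    (h : ∀ y ∈ Metric.ball (0 : V) r, ∃ k ∈ K, dist y k < δ) :
    Metric.ball (0 : V) (r - δ) ⊆ K := by
  intro w hw
  by_contra hwK
  rw [mem_ball_zero_iff] at hw
  obtain ⟨f, u, hfu, huw⟩ := geometric_hahn_banach_closed_point hK hKc hwK
  have key : ∀ v : V, ‖v‖ ≤ δ → f v ≤ u - f w + ‖f‖ * δ := by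
    intro v hv
    obtain ⟨k, hk, hd⟩ := h (w + v) (by
      rw [mem_ball_zero_iff]; linarith [norm_add_le w v])
    rw [dist_eq_norm] at hd
    have h1 : f (w + v - k) ≤ ‖f‖ * δ :=
      (le_abs_self _).trans ((f.le_opNorm _).trans (by gcongr))
    simp only [map_sub, map_add] at h1
    linarith [hfu k hk]
  have hn : ‖f‖ ≤ (u - f w + ‖f‖ * δ) / δ := by
    refine ContinuousLinearMap.opNorm_bound_of_ball_bound hδ _ f fun v hv => ?_
    rw [mem_closedBall_zero_iff] at hv
    have h1 := key v hv
    have h2 := key (-v) (by rwa [norm_neg])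
    rw [map_neg] at h2
    exact abs_le.2 ⟨by linarith, h1⟩
  rw [le_div_iff₀ hδ] at hn
  linarith

theorem LscAt.exists_ball_subset {X V : Type*} [TopologicalSpace X] [NormedAddCommGroup V]
    [NormedSpace ℝ V] [FiniteDimensional ℝ V] {Φ : X → Set V} {x : X} (hΦ : LscAt Φ x)
    (hconv : ∀ x', Convex ℝ (Φ x')) (h0 : Φ x ∈ 𝓝 0) :
    ∃ ε > 0, ∀ᶠ x' in 𝓝 x, Metric.ball (0 : V) ε ⊆ Φ x' := by
  have := FiniteDimensional.proper_real V
  obtain ⟨r, hr, hball⟩ := Metric.mem_nhds_iff.1 h0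
  have htb : TotallyBounded (Metric.ball (0 : V) r) :=
    (isCompact_closedBall 0 r).totallyBounded.subset Metric.ball_subset_closedBall
  obtain ⟨T, hTsub, hTfin, hTcov⟩ :=
    Metric.finite_approx_of_totallyBounded htb (r / 3) (by positivity)
  refine ⟨r / 3, by positivity, ?_⟩
  have hev : ∀ᶠ x' in 𝓝 x, ∀ t ∈ T, (Φ x' ∩ Metric.ball t (r / 3)).Nonempty :=
    (eventually_all_finite hTfin).2 fun t ht =>
      hΦ _ Metric.isOpen_ball ⟨t, hball (hTsub ht), Metric.mem_ball_self (by positivity)⟩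
  filter_upwards [hev] with x' hx'
  choose! k hk using hx'
  have hsub : convexHull ℝ (k '' T) ⊆ Φ x' :=
    convexHull_min (by rintro _ ⟨t, ht, rfl⟩; exact (hk t ht).1) (hconv x')
  refine Subset.trans ?_ hsub
  have := ball_subset_of_forall_exists_dist_lt (convex_convexHull ℝ (k '' T))
    ((hTfin.image k).isClosed_convexHull ℝ) (r := r) (δ := 2 * r / 3) (by positivity) fun y hy => by
      obtain ⟨t, ht, hyt⟩ := mem_iUnion₂.1 (hTcov hy)
      refine ⟨k t, subset_convexHull ℝ _ (mem_image_of_mem k ht), ?_⟩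
      have h1 := (hk t ht).2
      rw [Metric.mem_ball] at h1 hyt
      rw [dist_comm] at h1
      linarith [dist_triangle y t (k t)]
  convert this using 2
  ring

theorem LscAt.exists_isOpen_inter_subset {X E : Type*} [TopologicalSpace X]
    [NormedAddCommGroup E] [NormedSpace ℝ E] [FiniteDimensional ℝ E] {Φ : X → Set E} {x : X}
    (hΦ : LscAt Φ x) (hconv : ∀ x', Convex ℝ (Φ x')) {A : AffineSubspace ℝ E}
    (hA : ∀ x', Φ x' ⊆ A) {z : E} (hz : z ∈ A) {O : Set E} (hO : IsOpen O) (hzO : z ∈ O)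
    (hOA : O ∩ A ⊆ Φ x) :
    ∃ N : Set E, IsOpen N ∧ z ∈ N ∧ ∀ᶠ x' in 𝓝 x, N ∩ A ⊆ Φ x' := by
  let j : A.direction → E := fun v => (v : E) + z
  have hj : IsInducing j :=
    (Homeomorph.addRight z).isInducing.comp IsInducing.subtypeVal
  have hjA : ∀ v, j v ∈ A := fun v => AffineSubspace.vadd_mem_of_mem_direction v.2 hz
  have hlsc : LscAt (fun x' => j ⁻¹' Φ x') x := by
    intro Ω hΩ hne
    obtain ⟨Ω', hΩ', rfl⟩ := hj.isOpen_iff.1 hΩ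
    obtain ⟨v, hv, hv'⟩ := hne
    filter_upwards [hΦ Ω' hΩ' ⟨j v, hv, hv'⟩] with x' ⟨y, hy, hy'⟩
    have hyj : j ⟨y - z, AffineSubspace.vsub_mem_direction (hA x' hy) hz⟩ = y :=
      sub_add_cancel y z
    exact ⟨_, by rwa [mem_preimage, hyj], by rwa [mem_preimage, hyj]⟩
  have hc : ∀ x', Convex ℝ (j ⁻¹' Φ x') := fun x' =>
    ((hconv x').translate_preimage_left z).is_linear_preimage A.direction.subtype.isLinear
  obtain ⟨ε, hε, hev⟩ := hlsc.exists_ball_subset hc (by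
    filter_upwards [(hO.preimage hj.continuous).mem_nhds
      (show (0 : A.direction) ∈ j ⁻¹' O by simpa [j] using hzO)] with v hv
    exact hOA ⟨hv, hjA v⟩)
  refine ⟨Metric.ball z ε, Metric.isOpen_ball, Metric.mem_ball_self hε, ?_⟩
  filter_upwards [hev] with x' hx' y ⟨hy, hyA⟩
  have hmem := @hx' ⟨y - z, AffineSubspace.vsub_mem_direction hyA hz⟩ (by
    rw [mem_ball_zero_iff]; simpa [dist_eq_norm] using hy)
  simpa [j] using hmem

theorem exists_isOpen_of_mem_intrinsicInterior {E : Type*} [NormedAddCommGroup E]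
    [NormedSpace ℝ E] {s : Set E} {q : E} (hq : q ∈ intrinsicInterior ℝ s) :
    ∃ O : Set E, IsOpen O ∧ q ∈ O ∧ O ∩ affineSpan ℝ s ⊆ s := by
  obtain ⟨y, hy, rfl⟩ := mem_intrinsicInterior.1 hq
  obtain ⟨U, hU, hUo, hyU⟩ := mem_interior.1 hy
  obtain ⟨O, hO, rfl⟩ := isOpen_induced_iff.1 hUo
  exact ⟨O, hO, hyU, fun w hw => @hU ⟨w, hw.2⟩ hw.1⟩

theorem Convex.exists_isOpen_lineMap {E : Type*} [NormedAddCommGroup E] [NormedSpace ℝ E]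
    {s : Set E} (hs : Convex ℝ s) {p q : E} (hp : p ∈ s) {A : AffineSubspace ℝ E} (hA : s ⊆ A)
    {O : Set E} (hO : IsOpen O) (hq : q ∈ O) (hOA : O ∩ A ⊆ s) {t : ℝ} (ht : t ∈ Ioo (0 : ℝ) 1) :
    ∃ O' : Set E, IsOpen O' ∧ AffineMap.lineMap p q t ∈ O' ∧ O' ∩ A ⊆ s := by
  have ht0 : t ≠ 0 := ht.1.ne'
  refine ⟨(fun y => AffineMap.lineMap p y t⁻¹) ⁻¹' O, hO.preimage ?_, ?_, ?_⟩
  · simp only [AffineMap.lineMap_apply_module']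
    fun_prop
  · rw [mem_preimage]
    convert hq
    simp [AffineMap.lineMap_apply_module', smul_smul, ht0]
  · rintro y ⟨hy, hyA⟩
    have h1 := hs.lineMap_mem hp (hOA ⟨hy, AffineMap.lineMap_mem _ (hA hp) hyA⟩)
      ⟨ht.1.le, ht.2.le⟩
    convert h1
    simp [AffineMap.lineMap_apply_module', smul_smul, ht0]

/-- Proposition 3.2 (corrected version of Yuan's Theorem 1.13): if `Φ₁, Φ₂ : X ⇉ C` are
lower semicontinuous and convex-valued, `aff (Φ₂ x) = aff C` for all `x`, and
`Φ₁ x ∩ Φ₂ x ≠ ∅` implies `Φ₁ x ∩ ri (Φ₂ x) ≠ ∅`, then `x ↦ Φ₁ x ∩ Φ₂ x` is lower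
semicontinuous. Here `ri` is the relative interior (`intrinsicInterior`). -/
theorem lsc_inter_of_relativeInterior {n : ℕ} {X : Type*} [TopologicalSpace X]
    {C : Set (Fin n → ℝ)}
    (Φ₁ Φ₂ : X → Set (Fin n → ℝ))
    (hsub₁ : ∀ x : X, Φ₁ x ⊆ C) (hsub₂ : ∀ x : X, Φ₂ x ⊆ C)
    (hlsc₁ : ∀ x : X, LscAt Φ₁ x) (hlsc₂ : ∀ x : X, LscAt Φ₂ x)
    (hconv₁ : ∀ x : X, Convex ℝ (Φ₁ x)) (hconv₂ : ∀ x : X, Convex ℝ (Φ₂ x))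
    (haff : ∀ x : X, affineSpan ℝ (Φ₂ x) = affineSpan ℝ C)
    (hri : ∀ x : X, (Φ₁ x ∩ Φ₂ x).Nonempty → (Φ₁ x ∩ intrinsicInterior ℝ (Φ₂ x)).Nonempty) :
    ∀ x : X, LscAt (fun z => Φ₁ z ∩ Φ₂ z) x := by
  rintro x Ω hΩ ⟨p, ⟨hp₁, hp₂⟩, hpΩ⟩
  obtain ⟨q, hq₁, hq₂⟩ := hri x ⟨p, hp₁, hp₂⟩
  obtain ⟨O, hO, hqO, hOs⟩ := exists_isOpen_of_mem_intrinsicInterior hq₂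
  rw [haff x] at hOs
  have hC : C ⊆ affineSpan ℝ C := subset_affineSpan ℝ C
  have hcont : Tendsto (fun t : ℝ => AffineMap.lineMap p q t) (𝓝 0) (𝓝 p) := by
    have h : Continuous fun t : ℝ => AffineMap.lineMap p q t := AffineMap.lineMap_continuous
    simpa using h.tendsto 0
  have hΩev : ∀ᶠ t : ℝ in 𝓝[>] 0, AffineMap.lineMap p q t ∈ Ω :=
    (hcont.mono_left nhdsWithin_le_nhds).eventually (hΩ.mem_nhds hpΩ)
  obtain ⟨t, htΩ, ht⟩ := (hΩev.and (Ioo_mem_nhdsGT one_pos)).exists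
  obtain ⟨O', hO', hzO', hO's⟩ := (hconv₂ x).exists_isOpen_lineMap hp₂
    ((hsub₂ x).trans hC) hO hqO hOs ht
  have hz₁ : AffineMap.lineMap p q t ∈ Φ₁ x :=
    (hconv₁ x).lineMap_mem hp₁ hq₁ ⟨ht.1.le, ht.2.le⟩
  obtain ⟨N, hN, hzN, hev⟩ := (hlsc₂ x).exists_isOpen_inter_subset hconv₂
    (fun x' => (hsub₂ x').trans hC) (hC (hsub₁ x hz₁)) hO' hzO' hO's
  filter_upwards [hev, hlsc₁ x (Ω ∩ N) (hΩ.inter hN) ⟨_, hz₁, htΩ, hzN⟩]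
    with x' hx' ⟨y, hy, hyΩ, hyN⟩
  exact ⟨y, ⟨hy, hx' ⟨hyN, hC (hsub₁ x' hy)⟩⟩, hyΩ⟩
end
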